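/- arXiv:2207.04644 — 2 statements merged into one kernel-verified Lean document; each statement's English description precedes it below -/
import Mathlib

section
/- For all integers m, n ≥ 1, all j, k ∈ (1/2)ℤ, all τ in the complex upper half-plane and all z ∈ ℂ, the multiplication formula θ_{j,n}(τ,z)·θ_{k,m}(τ,z) = Σ_{r=0}^{m+n−1} θ_{2mnr+kn−jm, mn(m+n)}(τ,0)·θ_{j+k+2mr, m+n}(τ,z) holds (the summand is independent of the choice of representative r modulo m+n). -/
open Complex

/-- Jacobi theta function `θ_{j,m}(τ,z) = Σ_{n ∈ j/(2m)+ℤ} q^{m n²} e^{2πi m n z}`. -/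
noncomputable def jTheta (j m : ℝ) (τ z : ℂ) : ℂ :=
  ∑' n : ℤ, Complex.exp (2 * (Real.pi : ℂ) * Complex.I * (m : ℂ) *
    (((j / (2 * m) + (n : ℝ) : ℝ) : ℂ) ^ 2 * τ + ((j / (2 * m) + (n : ℝ) : ℝ) : ℂ) * z))

/-- `q^a := e^{2πiaτ}`. -/
noncomputable def qpow (τ : ℂ) (a : ℝ) : ℂ :=
  Complex.exp (2 * (Real.pi : ℂ) * Complex.I * (a : ℂ) * τ)

/-- Dedekind eta function. -/
noncomputable def dedekindEta (τ : ℂ) : ℂ :=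
  Complex.exp ((Real.pi : ℂ) * Complex.I * τ / 12) *
    ∏' n : ℕ, (1 - Complex.exp (2 * (Real.pi : ℂ) * Complex.I * ((n : ℂ) + 1) * τ))

/-- Mumford theta `ϑ00`. -/
noncomputable def v00 (τ z : ℂ) : ℂ := jTheta 0 2 τ z + jTheta 2 2 τ z
/-- Mumford theta `ϑ01`. -/
noncomputable def v01 (τ z : ℂ) : ℂ := jTheta 0 2 τ z - jTheta 2 2 τ z
/-- Mumford theta `ϑ10`. -/
noncomputable def v10 (τ z : ℂ) : ℂ := jTheta 1 2 τ z + jTheta (-1) 2 τ z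

/-- The summand of `jTheta`. -/
noncomputable def jThetaTerm (j m : ℝ) (τ z : ℂ) (n : ℤ) : ℂ :=
  Complex.exp (2 * (Real.pi : ℂ) * Complex.I * (m : ℂ) *
    (((j / (2 * m) + (n : ℝ) : ℝ) : ℂ) ^ 2 * τ + ((j / (2 * m) + (n : ℝ) : ℝ) : ℂ) * z))

theorem jThetaTerm_eq_mul_jacobiTheta₂_term (j m : ℝ) (τ z : ℂ) (n : ℤ) :
    jThetaTerm j m τ z n = jThetaTerm j m τ z 0 *
      jacobiTheta₂_term n (m * z + 2 * m * (j / (2 * m) : ℝ) * τ) (2 * m * τ) := by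
  simp only [jThetaTerm, jacobiTheta₂_term, ← Complex.exp_add]
  congr 1
  push_cast
  ring

theorem summable_jThetaTerm (j : ℝ) {m : ℝ} (hm : 0 < m) {τ : ℂ} (hτ : 0 < τ.im) (z : ℂ) :
    Summable (jThetaTerm j m τ z) := by
  rw [funext (jThetaTerm_eq_mul_jacobiTheta₂_term j m τ z)]
  refine Summable.mul_left _ ((summable_jacobiTheta₂_term_iff _ _).2 ?_)
  have h : (2 * (m : ℂ) * τ).im = 2 * m * τ.im := by simp
  rw [h]
  positivity

theorem jTheta_mul_jTheta (j k : ℝ) {m n : ℝ} (hm : 0 < m) (hn : 0 < n) {τ : ℂ}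
    (hτ : 0 < τ.im) (z w : ℂ) :
    jTheta j m τ z * jTheta k n τ w =
      ∑' p : ℤ × ℤ, jThetaTerm j m τ z p.1 * jThetaTerm k n τ w p.2 :=
  tsum_mul_tsum_of_summable_norm (summable_jThetaTerm j hm hτ z).norm
    (summable_jThetaTerm k hn hτ w).norm

/-- Pairs of integers `(a, b)` parametrized by the residue `r` and the quotient `s` of `b - a`
modulo `N`, together with `t = a + m * s`. -/
def intPairEquiv (N : ℕ) [NeZero N] (m : ℤ) : Fin N × ℤ × ℤ ≃ ℤ × ℤ where
  toFun x := (x.2.2 - m * x.2.1, x.2.2 - m * x.2.1 + (Int.divModEquiv N).symm (x.2.1, x.1))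
  invFun p :=
    ((Int.divModEquiv N (p.2 - p.1)).2, (Int.divModEquiv N (p.2 - p.1)).1,
      p.1 + m * (Int.divModEquiv N (p.2 - p.1)).1)
  left_inv := by
    rintro ⟨r, s, t⟩
    simp only [add_sub_cancel_left, Equiv.apply_symm_apply, sub_add_cancel]
  right_inv := by
    rintro ⟨a, b⟩
    simp only [Prod.mk.eta, Equiv.symm_apply_apply, add_sub_cancel_right, add_sub_cancel]

theorem jThetaTerm_mul_jThetaTerm {m n : ℝ} (hm : 0 < m) (hn : 0 < n) (j k : ℝ) (τ z : ℂ)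
    {a b r s t : ℤ} {m' : ℤ} (hm' : (m' : ℝ) = m) (ha : a = t - m' * s)
    (hb : (b : ℝ) = a + r + (m + n) * s) :
    jThetaTerm j n τ z a * jThetaTerm k m τ z b =
      jThetaTerm (2 * m * n * r + k * n - j * m) (m * n * (m + n)) τ 0 s *
        jThetaTerm (j + k + 2 * m * r) (m + n) τ z t := by
  have ha' : (a : ℝ) = t - m * s := by rw [ha, ← hm']; push_cast; ring
  rw [ha'] at hb
  have hmn : 0 < m + n := add_pos hm hn
  simp only [jThetaTerm, ← Complex.exp_add, ha', hb]
  congr 1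
  have hmc : (m : ℂ) ≠ 0 := by exact_mod_cast hm.ne'
  have hnc : (n : ℂ) ≠ 0 := by exact_mod_cast hn.ne'
  have hmnc : (m : ℂ) + n ≠ 0 := by exact_mod_cast hmn.ne'
  push_cast
  field_simp
  ring

/-- Lemma 2.1: multiplication formula for Jacobi theta functions. -/
theorem stmt_0 (m n : ℕ) (hm : 1 ≤ m) (hn : 1 ≤ n) (j k : ℝ)
    (hj : ∃ a : ℤ, j = a / 2) (hk : ∃ a : ℤ, k = a / 2)
    (τ : ℂ) (hτ : 0 < τ.im) (z : ℂ) :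
    jTheta j n τ z * jTheta k m τ z =
      ∑ r ∈ Finset.range (m + n),
        jTheta (2 * (m : ℝ) * n * r + k * n - j * m) ((m : ℝ) * n * (m + n)) τ 0 *
          jTheta (j + k + 2 * (m : ℝ) * r) ((m : ℝ) + n) τ z := by
  have hm0 : (0 : ℝ) < m := by exact_mod_cast hm
  have hn0 : (0 : ℝ) < n := by exact_mod_cast hn
  have : NeZero (m + n) := ⟨by omega⟩
  have hterm (x : Fin (m + n) × ℤ × ℤ) :
      jThetaTerm j n τ z (intPairEquiv (m + n) m x).1 *
          jThetaTerm k m τ z (intPairEquiv (m + n) m x).2 =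
        jThetaTerm (2 * (m : ℝ) * n * (x.1 : ℕ) + k * n - j * m) ((m : ℝ) * n * (m + n)) τ 0 x.2.1 *
          jThetaTerm (j + k + 2 * (m : ℝ) * (x.1 : ℕ)) ((m : ℝ) + n) τ z x.2.2 := by
    refine jThetaTerm_mul_jThetaTerm (m' := m) (r := (x.1 : ℕ)) hm0 hn0 j k τ z (by simp) rfl ?_
    simp [intPairEquiv, Int.divModEquiv]
    ring
  have hsum : Summable fun p : ℤ × ℤ ↦ jThetaTerm j n τ z p.1 * jThetaTerm k m τ z p.2 :=
    summable_mul_of_summable_norm (summable_jThetaTerm j hn0 hτ z).norm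
      (summable_jThetaTerm k hm0 hτ z).norm
  have hsum' : Summable fun x ↦ jThetaTerm j n τ z (intPairEquiv (m + n) m x).1 *
      jThetaTerm k m τ z (intPairEquiv (m + n) m x).2 :=
    hsum.comp_injective (intPairEquiv (m + n) m).injective
  rw [jTheta_mul_jTheta j k hn0 hm0 hτ, ← (intPairEquiv (m + n) m).tsum_eq,
    Summable.tsum_prod hsum', tsum_fintype, Finset.sum_range]
  refine Finset.sum_congr rfl fun r _ ↦ ?_
  rw [jTheta_mul_jTheta _ _ (by positivity) (by positivity) hτ]
  exact tsum_congr fun p ↦ hterm (r, p)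
end

section
/- For all τ in the complex upper half-plane and all z ∈ ℂ: ϑ00(τ,z)² = η(2τ)·(η(2τ)²/(η(τ)η(4τ)))²·ϑ00(2τ,2z) + 2·η(2τ)·(η(4τ)/η(2τ))²·ϑ10(2τ,2z). -/
open Complex

section TripleProduct

open Filter Topology

lemma norm_pow_lt_one {t : ℂ} (ht : ‖t‖ < 1) {n : ℕ} (hn : n ≠ 0) : ‖t ^ n‖ < 1 := by
  rw [norm_pow]
  exact pow_lt_one₀ (norm_nonneg _) ht hn

/-- The finite product `(p; p)_m`. -/
noncomputable def qPoch (p : ℂ) (m : ℕ) : ℂ := ∏ i ∈ Finset.range m, (1 - p ^ (i + 1))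

/-- The reciprocal of `(p; p)_m`, extended by zero to negative `m`. -/
noncomputable def qPochInv (p : ℂ) (m : ℤ) : ℂ :=
  if 0 ≤ m then (qPoch p m.toNat)⁻¹ else 0

lemma one_sub_pow_succ_ne_zero {p : ℂ} (hp : ‖p‖ < 1) (n : ℕ) : 1 - p ^ (n + 1) ≠ 0 := by
  intro h
  have h1 : ‖p ^ (n + 1)‖ < 1 := norm_pow_lt_one hp n.succ_ne_zero
  rw [← sub_eq_zero.mp h] at h1
  simp at h1

lemma qPoch_succ (p : ℂ) (m : ℕ) : qPoch p (m + 1) = qPoch p m * (1 - p ^ (m + 1)) :=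
  Finset.prod_range_succ _ _

lemma qPoch_ne_zero {p : ℂ} (hp : ‖p‖ < 1) (m : ℕ) : qPoch p m ≠ 0 :=
  Finset.prod_ne_zero_iff.mpr fun i _ ↦ one_sub_pow_succ_ne_zero hp i

lemma qPochInv_sub_one {p : ℂ} (hp : ‖p‖ < 1) (m : ℤ) :
    qPochInv p (m - 1) = (1 - p ^ m) * qPochInv p m := by
  rcases lt_trichotomy m 0 with hm | rfl | hm
  · simp [qPochInv, hm.not_ge, show ¬ (1 ≤ m) by omega]
  · simp [qPochInv]
  · obtain ⟨n, rfl⟩ : ∃ n : ℕ, m = n + 1 := ⟨(m - 1).toNat, by omega⟩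
    have h0 := qPoch_ne_zero hp n
    have h1 := one_sub_pow_succ_ne_zero hp n
    have h2 : ((n : ℤ) + 1).toNat = n + 1 := by omega
    rw [qPochInv, qPochInv, if_pos (by omega), if_pos (by omega), h2, qPoch_succ,
      add_sub_cancel_right, Int.toNat_natCast]
    rw [show p ^ ((n : ℤ) + 1) = p ^ (n + 1) by exact_mod_cast zpow_natCast p (n + 1)]
    field_simp

/-- The finite form of the Jacobi triple product identity. -/
lemma hasSum_finite_tripleProduct {q x : ℂ} (hq : ‖q‖ < 1) (hq0 : q ≠ 0) (hx : x ≠ 0) (a b : ℕ) :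
    HasSum (fun k : ℤ ↦ qPoch (q ^ 2) (a + b) * qPochInv (q ^ 2) (a - k) *
        qPochInv (q ^ 2) (b + k) * (q ^ (k ^ 2) * x ^ k))
      ((∏ i ∈ Finset.range a, (1 + x * q ^ (2 * i + 1))) *
        ∏ i ∈ Finset.range b, (1 + x⁻¹ * q ^ (2 * i + 1))) := by
  have hp : ‖q ^ 2‖ < 1 := norm_pow_lt_one hq two_ne_zero
  have hpz (n : ℤ) : (q ^ 2) ^ n = q ^ (2 * n) := by
    rw [zpow_mul]; norm_cast
  induction a with
  | zero =>
    induction b with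
    | zero =>
      convert hasSum_ite_eq (0 : ℤ) (1 : ℂ) using 2 with k
      rcases eq_or_ne k 0 with rfl | hk
      · simp [qPoch, qPochInv]
      · by_cases h : 0 ≤ k
        · simp [qPochInv, hk, show ¬ k ≤ 0 by omega]
        · simp [qPochInv, hk, h]
      · simp
    | succ b ih =>
      convert ih.add (((Equiv.addRight (1 : ℤ)).hasSum_iff.mpr ih).mul_right
        (x⁻¹ * q ^ (2 * b + 1))) using 1
      · funext k
        have e1 := qPochInv_sub_one hp (b + 1 + k)
        have e2 := qPochInv_sub_one hp (0 - k)
        rw [show (b : ℤ) + 1 + k - 1 = b + k by ring] at e1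
        simp only [Function.comp_apply, Equiv.coe_addRight, ← add_assoc, qPoch_succ, Nat.cast_zero,
          Nat.cast_succ]
        rw [show (0 : ℤ) - (k + 1) = 0 - k - 1 by ring,
          show (b : ℤ) + k + 1 = b + 1 + k by ring, e1, e2, hpz, hpz,
          show (k + 1) ^ 2 = k ^ 2 + 2 * k + 1 by ring, zero_add]
        have e3 : q ^ (2 * (b + 1 + k)) = q ^ (2 * b + 1) * q ^ (2 * k) * q := by
          rw [show 2 * ((b : ℤ) + 1 + k) = ((2 * b + 1 : ℕ) : ℤ) + 2 * k + 1 by push_cast; ring,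
            zpow_add₀ hq0, zpow_add₀ hq0, zpow_natCast, zpow_one]
        have e4 : q ^ (2 * (0 - k)) = (q ^ (2 * k))⁻¹ := by
          rw [← zpow_neg]; congr 1; ring
        have e5 : (q ^ 2) ^ (b + 1) = q ^ (2 * b + 1) * q := by ring
        have e6 := zpow_ne_zero (2 * k) hq0
        rw [e3, e4, e5, zpow_add₀ hq0, zpow_add₀ hq0, zpow_add₀ hx, zpow_one, zpow_one]
        field_simp
        ring
      · rw [Finset.prod_range_succ]
        ring
  | succ a ih =>
    convert ih.add (((Equiv.subRight (1 : ℤ)).hasSum_iff.mpr ih).mul_right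
      (x * q ^ (2 * a + 1))) using 1
    · funext k
      have e1 := qPochInv_sub_one hp (a + 1 - k)
      have e2 := qPochInv_sub_one hp (b + k)
      rw [show (a : ℤ) + 1 - k - 1 = a - k by ring] at e1
      simp only [Function.comp_apply, Equiv.subRight_apply, add_right_comm a 1 b, qPoch_succ,
        Nat.cast_succ]
      rw [show (a : ℤ) - (k - 1) = a + 1 - k by ring,
        show (b : ℤ) + (k - 1) = b + k - 1 by ring, e1, e2, hpz, hpz,
        show (k - 1) ^ 2 = k ^ 2 + (-2) * k + 1 by ring]
      have e3 : q ^ (2 * (a + 1 - k)) = q ^ (2 * a + 1) * q ^ (-2 * k) * q := by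
        rw [show 2 * ((a : ℤ) + 1 - k) = ((2 * a + 1 : ℕ) : ℤ) + (-2) * k + 1 by push_cast; ring,
          zpow_add₀ hq0, zpow_add₀ hq0, zpow_natCast, zpow_one]
      have e4 : q ^ (2 * (b + k)) = q ^ (2 * b) * (q ^ (-2 * k))⁻¹ := by
        rw [← zpow_neg, ← zpow_natCast q, ← zpow_add₀ hq0]; congr 1; push_cast; ring
      have e5 : (q ^ 2) ^ (a + b + 1) = q ^ (2 * a + 1) * q ^ (2 * b) * q := by ring
      have e6 := zpow_ne_zero (-2 * k) hq0
      rw [e3, e4, e5, zpow_add₀ hq0, zpow_add₀ hq0, zpow_sub₀ hx, zpow_one, zpow_one]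
      field_simp
      ring
    · rw [Finset.prod_range_succ]
      ring

lemma summable_norm_pow_comp {q : ℂ} (hq : ‖q‖ < 1) {e : ℕ → ℕ} (he : ∀ i, i ≤ e i) :
    Summable fun i ↦ ‖q ^ e i‖ := by
  refine (summable_geometric_of_lt_one (norm_nonneg q) hq).of_nonneg_of_le
    (fun _ ↦ norm_nonneg _) fun i ↦ ?_
  rw [norm_pow]
  exact pow_le_pow_of_le_one (norm_nonneg _) hq.le (he i)

lemma multipliable_one_add_mul_pow {q : ℂ} (hq : ‖q‖ < 1) (x : ℂ) {e : ℕ → ℕ}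
    (he : ∀ i, i ≤ e i) : Multipliable fun i ↦ 1 + x * q ^ e i := by
  refine multipliable_one_add_of_summable ?_
  simpa only [norm_mul] using (summable_norm_pow_comp hq he).mul_left ‖x‖

lemma tendsto_qPoch {p : ℂ} (hp : ‖p‖ < 1) :
    Tendsto (qPoch p) atTop (𝓝 (∏' n : ℕ, (1 - p ^ (n + 1)))) :=
  (ModularForm.multipliable_one_sub_pow hp).tendsto_prod_tprod_nat

lemma tprod_one_sub_pow_ne_zero {p : ℂ} (hp : ‖p‖ < 1) : ∏' n : ℕ, (1 - p ^ (n + 1)) ≠ 0 := by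
  simp_rw [sub_eq_add_neg]
  refine tprod_one_add_ne_zero_of_summable (fun i ↦ ?_) ?_
  · rw [← sub_eq_add_neg]
    exact one_sub_pow_succ_ne_zero hp i
  · simpa only [norm_neg] using summable_norm_pow_comp hp fun i ↦ i.le_succ

lemma exists_norm_qPoch_le {p : ℂ} (hp : ‖p‖ < 1) : ∃ C, ∀ m, ‖qPoch p m‖ ≤ C := by
  obtain ⟨C, hC⟩ := (tendsto_qPoch hp).norm.bddAbove_range
  exact ⟨C, fun m ↦ hC ⟨m, rfl⟩⟩

lemma exists_norm_qPochInv_le {p : ℂ} (hp : ‖p‖ < 1) : ∃ C, ∀ m, ‖qPochInv p m‖ ≤ C := by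
  obtain ⟨C, hC⟩ := ((tendsto_qPoch hp).inv₀ (tprod_one_sub_pow_ne_zero hp)).norm.bddAbove_range
  have hC' (m : ℕ) : ‖(qPoch p m)⁻¹‖ ≤ C := hC ⟨m, rfl⟩
  refine ⟨C, fun m ↦ ?_⟩
  rw [qPochInv]
  split_ifs
  · exact hC' _
  · simpa using (norm_nonneg _).trans (hC' 0)

lemma tendsto_qPochInv {p : ℂ} (hp : ‖p‖ < 1) :
    Tendsto (qPochInv p) atTop (𝓝 (∏' n : ℕ, (1 - p ^ (n + 1)))⁻¹) := by
  have h : Tendsto Int.toNat atTop atTop :=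
    tendsto_atTop.mpr fun n ↦ (eventually_ge_atTop (n : ℤ)).mono fun m hm ↦ by omega
  refine (((tendsto_qPoch hp).inv₀ (tprod_one_sub_pow_ne_zero hp)).comp h).congr' ?_
  filter_upwards [eventually_ge_atTop (0 : ℤ)] with m hm
  simp [qPochInv, hm]

/-- The Jacobi triple product identity. -/
theorem tsum_eq_tripleProduct {q x : ℂ} (hq : ‖q‖ < 1) (hq0 : q ≠ 0) (hx : x ≠ 0)
    (hs : Summable fun k : ℤ ↦ q ^ (k ^ 2) * x ^ k) :
    ∑' k : ℤ, q ^ (k ^ 2) * x ^ k = (∏' n : ℕ, (1 - (q ^ 2) ^ (n + 1))) *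
      ((∏' i : ℕ, (1 + x * q ^ (2 * i + 1))) * ∏' i : ℕ, (1 + x⁻¹ * q ^ (2 * i + 1))) := by
  have hp : ‖q ^ 2‖ < 1 := norm_pow_lt_one hq two_ne_zero
  set P := ∏' n : ℕ, (1 - (q ^ 2) ^ (n + 1))
  have hP0 : P ≠ 0 := tprod_one_sub_pow_ne_zero hp
  obtain ⟨C, hC⟩ := exists_norm_qPoch_le hp
  obtain ⟨D, hD⟩ := exists_norm_qPochInv_le hp
  have hC0 : 0 ≤ C := (norm_nonneg _).trans (hC 0)
  have hD0 : 0 ≤ D := (norm_nonneg _).trans (hD 0)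
  have hcast : Tendsto (Nat.cast : ℕ → ℤ) atTop atTop := tendsto_natCast_atTop_atTop
  have hsum := tendsto_tsum_of_dominated_convergence (𝓕 := atTop)
    (f := fun (n : ℕ) (k : ℤ) ↦ qPoch (q ^ 2) (n + n) * qPochInv (q ^ 2) (n - k) *
        qPochInv (q ^ 2) (n + k) * (q ^ (k ^ 2) * x ^ k))
    (g := fun k ↦ P * P⁻¹ * P⁻¹ * (q ^ (k ^ 2) * x ^ k))
    (hs.norm.mul_left (C * D * D)) (fun k ↦ by
      refine Tendsto.mul_const _ (((tendsto_qPoch hp).comp ?_).mul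
        ((tendsto_qPochInv hp).comp ?_) |>.mul ((tendsto_qPochInv hp).comp ?_))
      · exact tendsto_atTop_mono (fun n ↦ Nat.le_add_left n n) tendsto_id
      · exact tendsto_atTop_add_const_right _ (-k) hcast
      · exact tendsto_atTop_add_const_right _ k hcast)
    (.of_forall fun n k ↦ by
      rw [norm_mul, norm_mul, norm_mul]
      gcongr
      exacts [hC _, hD _, hD _])
  simp_rw [(hasSum_finite_tripleProduct hq hq0 hx _ _).tsum_eq] at hsum
  have hprod (y : ℂ) := (multipliable_one_add_mul_pow hq y (e := fun i ↦ 2 * i + 1)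
    fun i ↦ by omega).tendsto_prod_tprod_nat
  have := tendsto_nhds_unique hsum ((hprod x).mul (hprod x⁻¹))
  rw [← this, tsum_mul_left]
  field_simp

end TripleProduct

section ThetaEta

open ModularForm

/-- Euler's product in the nome. -/
noncomputable def eulerProd (t : ℂ) : ℂ := ∏' n : ℕ, (1 - t ^ (n + 1))

lemma eulerProd_ne_zero {t : ℂ} (ht : ‖t‖ < 1) : eulerProd t ≠ 0 := tprod_one_sub_pow_ne_zero ht

lemma tprod_one_add_pow_succ {t : ℂ} (ht : ‖t‖ < 1) :
    ∏' n : ℕ, (1 + t ^ (n + 1)) = eulerProd (t ^ 2) / eulerProd t := by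
  have h : Multipliable fun n : ℕ ↦ 1 + t ^ (n + 1) := by
    simpa using multipliable_one_add_mul_pow ht 1 (e := fun n ↦ n + 1) fun n ↦ n.le_succ
  rw [eq_div_iff (eulerProd_ne_zero ht), eulerProd, eulerProd,
    ← h.tprod_mul (multipliable_one_sub_pow ht)]
  congr 1 with n
  ring

lemma tprod_one_add_pow {t : ℂ} (ht : ‖t‖ < 1) :
    ∏' n : ℕ, (1 + t ^ n) = 2 * (eulerProd (t ^ 2) / eulerProd t) := by
  have h : Multipliable fun n : ℕ ↦ 1 + t ^ (n + 1) := by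
    simpa using multipliable_one_add_mul_pow ht 1 (e := fun n ↦ n + 1) fun n ↦ n.le_succ
  rw [tprod_eq_zero_mul' (f := fun n ↦ 1 + t ^ n) h, tprod_one_add_pow_succ ht, pow_zero,
    one_add_one_eq_two]

lemma tprod_one_add_pow_odd {t : ℂ} (ht : ‖t‖ < 1) :
    ∏' n : ℕ, (1 + t ^ (2 * n + 1)) =
      eulerProd (t ^ 2) ^ 2 / (eulerProd t * eulerProd (t ^ 4)) := by
  have ho : Multipliable fun n : ℕ ↦ 1 + t ^ (2 * n + 1) := by
    simpa using multipliable_one_add_mul_pow ht 1 (e := fun n ↦ 2 * n + 1) fun n ↦ by omega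
  have he : Multipliable fun n : ℕ ↦ 1 + t ^ (2 * n + 1 + 1) := by
    simpa using multipliable_one_add_mul_pow ht 1 (e := fun n ↦ 2 * n + 1 + 1) fun n ↦ by omega
  have h := tprod_even_mul_odd (f := fun n ↦ 1 + t ^ (n + 1)) ho he
  have h2 := tprod_one_add_pow_succ (norm_pow_lt_one ht two_ne_zero)
  simp_rw [← pow_mul] at h2
  simp_rw [mul_add, mul_one, add_assoc, Nat.reduceAdd, Nat.reduceMul] at h2 h
  rw [tprod_one_add_pow_succ ht, h2] at h
  have h1 := eulerProd_ne_zero ht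
  have h2 := eulerProd_ne_zero (norm_pow_lt_one ht two_ne_zero)
  have h4 := eulerProd_ne_zero (norm_pow_lt_one ht four_ne_zero)
  field_simp at h ⊢
  linear_combination h

lemma jacobiTheta₂_term_eq_zpow (k : ℤ) (z τ : ℂ) :
    jacobiTheta₂_term k z τ = cexp (Real.pi * I * τ) ^ (k ^ 2) * cexp (2 * Real.pi * I * z) ^ k := by
  rw [jacobiTheta₂_term, ← exp_int_mul, ← exp_int_mul, ← exp_add]
  congr 1
  push_cast
  ring

lemma norm_exp_pi_mul_I_lt_one {τ : ℂ} (hτ : 0 < τ.im) : ‖cexp (Real.pi * I * τ)‖ < 1 := by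
  rw [norm_exp, Real.exp_lt_one_iff]
  simpa using mul_pos Real.pi_pos hτ

/-- The Jacobi triple product identity for the two-variable theta function. -/
lemma jacobiTheta₂_eq_tripleProduct (z : ℂ) {τ : ℂ} (hτ : 0 < τ.im) :
    jacobiTheta₂ z τ = eulerProd (cexp (Real.pi * I * τ) ^ 2) *
      ((∏' i : ℕ, (1 + cexp (2 * Real.pi * I * z) * cexp (Real.pi * I * τ) ^ (2 * i + 1))) *
        ∏' i : ℕ, (1 + (cexp (2 * Real.pi * I * z))⁻¹ * cexp (Real.pi * I * τ) ^ (2 * i + 1))) := by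
  have hs := (summable_jacobiTheta₂_term_iff z τ).mpr hτ
  simp_rw [jacobiTheta₂_term_eq_zpow] at hs
  simp_rw [jacobiTheta₂, jacobiTheta₂_term_eq_zpow]
  exact tsum_eq_tripleProduct (norm_exp_pi_mul_I_lt_one hτ) (exp_ne_zero _) (exp_ne_zero _) hs

lemma dedekindEta_eq (τ : ℂ) :
    dedekindEta τ = cexp (Real.pi * I * τ / 12) * eulerProd (cexp (2 * Real.pi * I * τ)) := by
  rw [dedekindEta, eulerProd]
  congr 3 with n
  rw [← exp_nat_mul]
  congr 2
  push_cast
  ring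

lemma dedekindEta_nat_mul (m : ℕ) (τ : ℂ) :
    dedekindEta (m * τ) =
      cexp (Real.pi * I * τ / 12) ^ m * eulerProd (cexp (2 * Real.pi * I * τ) ^ m) := by
  rw [dedekindEta_eq, ← exp_nat_mul, ← exp_nat_mul]
  congr 3 <;> ring

lemma jacobiTheta₂_zero_two_mul {τ : ℂ} (hτ : 0 < τ.im) :
    jacobiTheta₂ 0 (2 * τ) = dedekindEta (2 * τ) *
      (dedekindEta (2 * τ) ^ 2 / (dedekindEta τ * dedekindEta (4 * τ))) ^ 2 := by
  have hτ2 : 0 < (2 * τ).im := by simpa using hτ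
  have h2 := dedekindEta_nat_mul 2 τ
  have h4 := dedekindEta_nat_mul 4 τ
  push_cast at h2 h4
  rw [jacobiTheta₂_eq_tripleProduct _ hτ2, h2, h4, dedekindEta_eq τ]
  have hQ := norm_exp_pi_mul_I_lt_one hτ2
  rw [show Real.pi * I * (2 * τ) = 2 * Real.pi * I * τ by ring] at hQ ⊢
  have hE := exp_ne_zero (Real.pi * I * τ / 12)
  simp only [mul_zero, exp_zero, inv_one, one_mul, tprod_one_add_pow_odd hQ]
  have e1 := eulerProd_ne_zero hQ
  have e4 := eulerProd_ne_zero (norm_pow_lt_one hQ four_ne_zero)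
  field_simp

lemma exp_mul_jacobiTheta₂_self_two_mul {τ : ℂ} (hτ : 0 < τ.im) :
    cexp (Real.pi * I * τ / 2) * jacobiTheta₂ τ (2 * τ) =
      2 * dedekindEta (2 * τ) * (dedekindEta (4 * τ) / dedekindEta (2 * τ)) ^ 2 := by
  have hτ2 : 0 < (2 * τ).im := by simpa using hτ
  have h2 := dedekindEta_nat_mul 2 τ
  have h4 := dedekindEta_nat_mul 4 τ
  push_cast at h2 h4
  rw [jacobiTheta₂_eq_tripleProduct _ hτ2, h2, h4]
  have hQ := norm_exp_pi_mul_I_lt_one hτ2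
  rw [show Real.pi * I * (2 * τ) = 2 * Real.pi * I * τ by ring] at hQ ⊢
  rw [show cexp (Real.pi * I * τ / 2) = cexp (Real.pi * I * τ / 12) ^ 6 by
    rw [← exp_nat_mul]; congr 1; push_cast; ring]
  have hE := exp_ne_zero (Real.pi * I * τ / 12)
  have hQ0 := exp_ne_zero (2 * Real.pi * I * τ)
  set Q := cexp (2 * Real.pi * I * τ)
  have hQ2 := norm_pow_lt_one hQ two_ne_zero
  have e2 := eulerProd_ne_zero hQ2
  have hb := tprod_one_add_pow_succ hQ2
  have hb1 : ∏' i : ℕ, (1 + Q * Q ^ (2 * i + 1)) = eulerProd (Q ^ 4) / eulerProd (Q ^ 2) := by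
    rw [show Q ^ 4 = (Q ^ 2) ^ 2 by ring, ← hb]
    congr 1 with i
    ring
  have hb2 : ∏' i : ℕ, (1 + Q⁻¹ * Q ^ (2 * i + 1)) =
      2 * (eulerProd (Q ^ 4) / eulerProd (Q ^ 2)) := by
    have : ∀ i : ℕ, 1 + Q⁻¹ * Q ^ (2 * i + 1) = 1 + (Q ^ 2) ^ i := fun i ↦ by
      field_simp
      ring
    simp_rw [this]
    rw [tprod_one_add_pow hQ2, ← pow_mul]
  rw [hb1, hb2]
  field_simp

end ThetaEta

section ThetaSquare

lemma hasSum_int_even_odd {f : ℤ → ℂ} {a b : ℂ} (he : HasSum (fun k ↦ f (2 * k)) a)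
    (ho : HasSum (fun k ↦ f (2 * k + 1)) b) : HasSum f (a + b) := by
  have h2 := mul_right_injective₀ (two_ne_zero' ℤ)
  replace ho := ((add_left_injective 1).comp h2).hasSum_range_iff.2 ho
  refine (h2.hasSum_range_iff.2 he).add_isCompl ?_ ho
  simpa [Function.comp_def] using Int.isCompl_even_odd

lemma tsum_int_even_add_odd {f : ℤ → ℂ} (hf : Summable f) :
    ∑' k, f k = ∑' k, f (2 * k) + ∑' k, f (2 * k + 1) := by
  have h2 := mul_right_injective₀ (two_ne_zero' ℤ)
  exact (hasSum_int_even_odd (hf.comp_injective h2).hasSum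
    (hf.comp_injective ((add_left_injective 1).comp h2)).hasSum).tsum_eq

lemma v00_eq {τ : ℂ} (hτ : 0 < τ.im) (z : ℂ) : v00 τ z = jacobiTheta₂ z τ := by
  rw [v00, jTheta, jTheta, jacobiTheta₂,
    tsum_int_even_add_odd ((summable_jacobiTheta₂_term_iff z τ).mpr hτ)]
  congr 2 <;> funext n <;> rw [jacobiTheta₂_term] <;> congr 1 <;> push_cast <;> ring

lemma v10_eq {τ : ℂ} (hτ : 0 < τ.im) (z : ℂ) :
    v10 τ z = cexp (Real.pi * I * τ / 4 + Real.pi * I * z) * jacobiTheta₂ (z + τ / 2) τ := by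
  rw [v10, jTheta, jTheta, jacobiTheta₂,
    tsum_int_even_add_odd ((summable_jacobiTheta₂_term_iff (z + τ / 2) τ).mpr hτ), mul_add,
    ← tsum_mul_left, ← tsum_mul_left]
  congr 1
  · congr 1 with n
    rw [jacobiTheta₂_term, ← exp_add]
    congr 1
    push_cast
    ring
  · rw [← (Equiv.addRight (1 : ℤ)).tsum_eq]
    congr 1 with n
    rw [jacobiTheta₂_term, ← exp_add, Equiv.coe_addRight]
    congr 1
    push_cast
    ring

lemma tsum_jacobiTheta₂_term_mul_even (z τ : ℂ) (v : ℤ) :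
    ∑' a, jacobiTheta₂_term a z τ * jacobiTheta₂_term (a + 2 * v) z τ =
      jacobiTheta₂_term v 0 (2 * τ) * jacobiTheta₂ (2 * z) (2 * τ) := by
  rw [← (Equiv.subRight v).tsum_eq, jacobiTheta₂, ← tsum_mul_left]
  congr 1 with u
  simp only [jacobiTheta₂_term, ← exp_add, Equiv.subRight_apply]
  congr 1
  push_cast
  ring

lemma tsum_jacobiTheta₂_term_mul_odd (z τ : ℂ) (v : ℤ) :
    ∑' a, jacobiTheta₂_term a z τ * jacobiTheta₂_term (a + (2 * v + 1)) z τ =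
      jacobiTheta₂_term v τ (2 * τ) *
        (cexp (Real.pi * I * τ + 2 * Real.pi * I * z) * jacobiTheta₂ (2 * z + τ) (2 * τ)) := by
  rw [← (Equiv.subRight v).tsum_eq, jacobiTheta₂, ← tsum_mul_left, ← tsum_mul_left]
  congr 1 with u
  simp only [jacobiTheta₂_term, ← exp_add, Equiv.subRight_apply]
  congr 1
  push_cast
  ring

lemma jacobiTheta₂_sq (z : ℂ) {τ : ℂ} (hτ : 0 < τ.im) :
    jacobiTheta₂ z τ ^ 2 = jacobiTheta₂ 0 (2 * τ) * jacobiTheta₂ (2 * z) (2 * τ) +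
      jacobiTheta₂ τ (2 * τ) *
        (cexp (Real.pi * I * τ + 2 * Real.pi * I * z) * jacobiTheta₂ (2 * z + τ) (2 * τ)) := by
  have hs := ((summable_jacobiTheta₂_term_iff z τ).mpr hτ).norm
  let shear : ℤ × ℤ ≃ ℤ × ℤ :=
    { toFun := fun p ↦ (p.2, p.2 + p.1)
      invFun := fun p ↦ (p.2 - p.1, p.1)
      left_inv := fun p ↦ by simp
      right_inv := fun p ↦ by simp }
  have hprod : Summable fun p : ℤ × ℤ ↦
      jacobiTheta₂_term (shear p).1 z τ * jacobiTheta₂_term (shear p).2 z τ :=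
    shear.summable_iff.mpr (summable_mul_of_summable_norm hs hs)
  rw [sq, jacobiTheta₂, tsum_mul_tsum_of_summable_norm hs hs, ← shear.tsum_eq, hprod.tsum_prod,
    tsum_int_even_add_odd hprod.prod]
  simp only [shear, Equiv.coe_fn_mk, tsum_jacobiTheta₂_term_mul_even,
    tsum_jacobiTheta₂_term_mul_odd, tsum_mul_right]
  rfl

end ThetaSquare

/-- Lemma 2.2 (1): `ϑ00(τ,z)²`. -/
theorem stmt_1 (τ : ℂ) (hτ : 0 < τ.im) (z : ℂ) :
    v00 τ z ^ 2 =
      dedekindEta (2 * τ) *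
          (dedekindEta (2 * τ) ^ 2 / (dedekindEta τ * dedekindEta (4 * τ))) ^ 2 *
          v00 (2 * τ) (2 * z)
        + 2 * dedekindEta (2 * τ) * (dedekindEta (4 * τ) / dedekindEta (2 * τ)) ^ 2 *
          v10 (2 * τ) (2 * z) := by
  have hτ2 : 0 < (2 * τ).im := by simpa using hτ
  rw [v00_eq hτ, v00_eq hτ2, v10_eq hτ2, jacobiTheta₂_sq z hτ, jacobiTheta₂_zero_two_mul hτ,
    ← exp_mul_jacobiTheta₂_self_two_mul hτ, mul_div_cancel_left₀ τ two_ne_zero,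
    show Real.pi * I * τ + 2 * Real.pi * I * z =
      Real.pi * I * τ / 2 + (Real.pi * I * (2 * τ) / 4 + Real.pi * I * (2 * z)) by ring,
    exp_add (Real.pi * I * τ / 2)]
  ring
end
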